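/- In the singular Minkowski plane (ℝ², N), the horofunction φ₊(x₁,x₂) = x₂ − x₁ is not a Busemann function: there exist no map c : [0,∞) → ℝ² with N(c(s) − c(t)) = |s − t| for all s,t ≥ 0 (a ray of (ℝ²,N)) and no constant C ∈ ℝ such that for every (x₁,x₂) ∈ ℝ², lim_{t→+∞}(N((x₁,x₂) − c(t)) − t) = x₂ − x₁ + C. -/

import Mathlib

open Filter

/-- The norm of the singular Minkowski plane. -/
noncomputable def singN (x : ℝ × ℝ) : ℝ :=
  Real.sqrt (x.1 ^ 2 + 2 * x.2 ^ 2) + |x.2|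

/-- The functional `x₁ - x₂` is dominated by `singN`, with equality only on the horizontal axis. -/
theorem snd_eq_zero_of_singN_eq {d : ℝ × ℝ} (h : singN d = d.1 - d.2) : d.2 = 0 := by
  unfold singN at h
  have habs := neg_abs_le d.2
  have hle : Real.sqrt (d.1 ^ 2 + 2 * d.2 ^ 2) ≤ d.1 := by linarith
  have hsq := Real.sq_sqrt (show 0 ≤ d.1 ^ 2 + 2 * d.2 ^ 2 by positivity)
  have hpow := pow_le_pow_left₀ (Real.sqrt_nonneg _) hle 2
  have hzero : d.2 ^ 2 = 0 := le_antisymm (by linarith) (sq_nonneg _)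
  exact pow_eq_zero_iff two_ne_zero |>.mp hzero

/-- In the singular Minkowski plane, the horofunction `φ₊(x₁,x₂) = x₂ - x₁` is not a
Busemann function: no ray `c` and constant `C` satisfy
`lim_{t→∞} (singN (x - c t) - t) = x₂ - x₁ + C` for all `x`. -/
theorem horofunction_not_busemann :
    ¬ ∃ (c : ℝ → ℝ × ℝ) (C : ℝ),
      (∀ s t : ℝ, 0 ≤ s → 0 ≤ t → singN (c s - c t) = |s - t|) ∧
      ∀ x : ℝ × ℝ,
        Tendsto (fun t : ℝ => singN (x - c t) - t) atTop (nhds (x.2 - x.1 + C)) := by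
  rintro ⟨c, C, hray, hlim⟩
  have hc (s : ℝ) (hs : 0 ≤ s) : (c s).2 - (c s).1 + C = -s := by
    refine tendsto_nhds_unique (hlim (c s)) (tendsto_const_nhds.congr' ?_)
    filter_upwards [eventually_ge_atTop s] with t ht
    rw [hray s t hs (hs.trans ht), abs_of_nonpos (by linarith)]
    ring
  have hconst (t : ℝ) (ht : 0 ≤ t) : (c t).2 = (c 0).2 := by
    refine sub_eq_zero.mp (snd_eq_zero_of_singN_eq (d := c t - c 0) ?_)
    rw [hray t 0 ht le_rfl, sub_zero, abs_of_nonneg ht]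
    have h0 := hc 0 le_rfl
    have h1 := hc t ht
    simp only [Prod.fst_sub, Prod.snd_sub]
    linarith
  have hsymm := tendsto_nhds_unique (hlim (0, (c 0).2 + 1))
    ((hlim (0, (c 0).2 - 1)).congr' (by
      filter_upwards [eventually_ge_atTop 0] with t ht
      simp [singN, hconst t ht]))
  simp only at hsymm
  linarith
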